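/- arXiv:2311.11151 — 7 statements merged into one kernel-verified Lean document; each statement's English description precedes it below -/
import Mathlib

section
/- Assume v ≠ 0. For every integer k with 0 ≤ k ≤ n−1, A^k B₁ = v^{k+1} e_{n−k}. Consequently, the controllability matrix Ctr(A,B₁) has (i,j) entry equal to v^j when i = n−j+1 and 0 otherwise (an anti-diagonal matrix), and Ctr(A,B₁) is invertible. -/
open Matrix

noncomputable section

/-- The state matrix `A`: `A₁,₁ = r`, superdiagonal entries `v`, all else `0`. -/
def matA (n : ℕ) (r v : ℝ) : Matrix (Fin n) (Fin n) ℝ :=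
  Matrix.of fun i j => if (i : ℕ) = 0 ∧ (j : ℕ) = 0 then r
    else if (j : ℕ) = (i : ℕ) + 1 then v else 0

/-- The input vector `B(b)`: first entry `b`, last entry `v`, all else `0`. -/
def vecB (n : ℕ) (v b : ℝ) : Fin n → ℝ :=
  fun i => if (i : ℕ) = 0 then b else if (i : ℕ) = n - 1 then v else 0

/-- Controllability matrix `[B, AB, …, A^{n-1}B]` (column `j` is `A^j B`). -/
def ctrM (n : ℕ) (A : Matrix (Fin n) (Fin n) ℝ) (B : Fin n → ℝ) :
    Matrix (Fin n) (Fin n) ℝ :=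
  Matrix.of fun i j => ((A ^ (j : ℕ)) *ᵥ B) i

theorem stmt0 (n : ℕ) (hn : 2 ≤ n) (r v : ℝ) (hv : v ≠ 0) :
    (∀ k : ℕ, k ≤ n - 1 →
      (matA n r v ^ k) *ᵥ vecB n v 0 =
        v ^ (k + 1) • (Pi.single (⟨n - 1 - k, by omega⟩ : Fin n) (1 : ℝ) : Fin n → ℝ)) ∧
    ctrM n (matA n r v) (vecB n v 0) =
      Matrix.of (fun i j : Fin n =>
        if (i : ℕ) = n - 1 - (j : ℕ) then v ^ ((j : ℕ) + 1) else 0) ∧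
    IsUnit (ctrM n (matA n r v) (vecB n v 0)) := by
  have h1 : ∀ k : ℕ, k ≤ n - 1 →
      (matA n r v ^ k) *ᵥ vecB n v 0 =
        v ^ (k + 1) • (Pi.single (⟨n - 1 - k, by omega⟩ : Fin n) (1 : ℝ) : Fin n → ℝ) := by
    intro k
    induction k with
    | zero =>
      intro _
      ext i
      simp only [pow_zero, Matrix.one_mulVec, vecB, Pi.smul_apply, Pi.single_apply, Fin.ext_iff,
        smul_eq_mul]
      split_ifs <;> first | omega | simp
    | succ k ih =>
      intro hk
      rw [pow_succ', ← Matrix.mulVec_mulVec, ih (by omega), Matrix.mulVec_smul,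
        Matrix.mulVec_single_one]
      ext i
      simp only [matA, Matrix.col_apply, Matrix.of_apply, Pi.smul_apply, Pi.single_apply,
        Fin.ext_iff, smul_eq_mul]
      split_ifs <;> first | omega | ring
  have h2 : ctrM n (matA n r v) (vecB n v 0) =
      Matrix.of (fun i j : Fin n =>
        if (i : ℕ) = n - 1 - (j : ℕ) then v ^ ((j : ℕ) + 1) else 0) := by
    ext i j
    simp only [ctrM, Matrix.of_apply]
    rw [h1 j (by omega)]
    simp [Pi.single_apply, Fin.ext_iff]
  refine ⟨h1, h2, ?_⟩
  rw [h2]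
  refine IsUnit.of_mul_eq_one (Matrix.of (fun i j : Fin n =>
        if (i : ℕ) = n - 1 - (j : ℕ) then (v ^ ((i : ℕ) + 1))⁻¹ else 0)) ?_
  ext i j
  rw [Matrix.mul_apply, Finset.sum_eq_single (⟨n - 1 - i, by omega⟩ : Fin n)]
  · simp only [Matrix.of_apply, Matrix.one_apply, Fin.ext_iff]
    have := i.2
    have := j.2
    split_ifs <;> first | omega | simp [hv]
  · intro b _ hb
    have := i.2
    have := b.2
    simp only [ne_eq, Fin.ext_iff] at hb
    simp only [Matrix.of_apply]
    rw [if_neg (by omega), zero_mul]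
  · simp
end
end

section
/- Assume v ≠ 0. Then eₙᵀ Ctr(A,B₁)^{-1} = v^{-n} e₁ᵀ; that is, the last row of the inverse of the controllability matrix of (A,B₁) equals (v^{-n}, 0, …, 0). Equivalently, the first row of Ctr(A,B₁) equals vⁿ eₙᵀ and Ctr(A,B₁) is invertible. -/
open Matrix

noncomputable section

theorem aux_pow (n : ℕ) (hn : 2 ≤ n) (r v : ℝ) (j : ℕ) (hj : j < n) :
    ∀ i : Fin n, ((matA n r v ^ j) *ᵥ vecB n v 0) i =
      if (i : ℕ) + j = n - 1 then v ^ (j + 1) else 0 := by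
  induction j with
  | zero =>
    intro i
    simp only [pow_zero, Matrix.one_mulVec, vecB]
    split_ifs <;> first | omega | simp
  | succ j ih =>
    intro i
    have ih' := ih (by omega)
    rw [pow_succ', ← Matrix.mulVec_mulVec]
    change ∑ k, matA n r v i k * ((matA n r v ^ j) *ᵥ vecB n v 0) k = _
    simp only [ih']
    simp only [matA, Matrix.of_apply]
    by_cases h : (i : ℕ) + 1 < n
    · rw [Finset.sum_eq_single (⟨(i : ℕ) + 1, h⟩ : Fin n)]
      · have e : (i : ℕ) + 1 + j = (i : ℕ) + (j + 1) := by omega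
        simp only [e]
        split_ifs <;> first | omega | tauto | ring
      · intro k _ hk
        have hk' : (k : ℕ) ≠ (i : ℕ) + 1 := fun h' => hk (Fin.ext h')
        split_ifs <;> first | omega | simp
      · simp
    · rw [if_neg (by omega)]
      apply Finset.sum_eq_zero
      intro k _
      have := k.2
      split_ifs <;> first | omega | simp

theorem aux_ctr (n : ℕ) (hn : 2 ≤ n) (r v : ℝ) (i j : Fin n) :
    ctrM n (matA n r v) (vecB n v 0) i j =
      if j = Fin.rev i then v ^ ((j : ℕ) + 1) else 0 := by
  have h : (j = Fin.rev i) ↔ ((i : ℕ) + j = n - 1) := by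
    rw [Fin.ext_iff, Fin.val_rev]; omega
  simp only [ctrM, Matrix.of_apply, aux_pow n hn r v j j.2, h]

theorem aux_unit (n : ℕ) (hn : 2 ≤ n) (r v : ℝ) (hv : v ≠ 0) :
    IsUnit (ctrM n (matA n r v) (vecB n v 0)) := by
  have h : ctrM n (matA n r v) (vecB n v 0) *
      (Matrix.of fun i j : Fin n => if j = Fin.rev i then (v ^ ((i : ℕ) + 1))⁻¹ else 0) = 1 := by
    ext i j
    rw [Matrix.mul_apply, Finset.sum_eq_single (Fin.rev i)]
    · rw [aux_ctr n hn, if_pos rfl, Matrix.of_apply, Fin.rev_rev, Matrix.one_apply]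
      by_cases hij : i = j
      · rw [if_pos hij.symm, if_pos hij, mul_inv_cancel₀ (pow_ne_zero _ hv)]
      · rw [if_neg (Ne.symm hij), if_neg hij, mul_zero]
    · intro k _ hk
      rw [aux_ctr n hn, if_neg hk, zero_mul]
    · simp
  exact (Matrix.isUnit_iff_isUnit_det _).2 (Matrix.isUnit_det_of_right_inverse h)

theorem stmt1 (n : ℕ) (hn : 2 ≤ n) (r v : ℝ) (hv : v ≠ 0) :
    IsUnit (ctrM n (matA n r v) (vecB n v 0)) ∧
    -- last row of the inverse of the controllability matrix is `v⁻ⁿ e₁ᵀ`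
    (Pi.single (⟨n - 1, by omega⟩ : Fin n) (1 : ℝ)) ᵥ*
        (ctrM n (matA n r v) (vecB n v 0))⁻¹ =
      v ^ (-(n : ℤ)) • (Pi.single (⟨0, by omega⟩ : Fin n) (1 : ℝ) : Fin n → ℝ) ∧
    -- equivalently, the first row of the controllability matrix is `vⁿ eₙᵀ`
    (Pi.single (⟨0, by omega⟩ : Fin n) (1 : ℝ)) ᵥ*
        ctrM n (matA n r v) (vecB n v 0) =
      v ^ n • (Pi.single (⟨n - 1, by omega⟩ : Fin n) (1 : ℝ) : Fin n → ℝ) := by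
  have hu := aux_unit n hn r v hv
  have hrow : (Pi.single (⟨0, by omega⟩ : Fin n) (1 : ℝ)) ᵥ*
        ctrM n (matA n r v) (vecB n v 0) =
      v ^ n • (Pi.single (⟨n - 1, by omega⟩ : Fin n) (1 : ℝ) : Fin n → ℝ) := by
    ext j
    rw [Matrix.single_one_vecMul, Matrix.row_apply, aux_ctr n hn, Pi.smul_apply, Pi.single_apply]
    have e : Fin.rev (⟨0, by omega⟩ : Fin n) = ⟨n - 1, by omega⟩ := by
      rw [Fin.ext_iff, Fin.val_rev]
    rw [e]
    split_ifs with h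
    · subst h
      simp only [smul_eq_mul, mul_one]
      congr 1
      omega
    · simp
  refine ⟨hu, ?_, hrow⟩
  have h2 := congrArg (fun w => v ^ (-(n : ℤ)) • (w ᵥ* (ctrM n (matA n r v) (vecB n v 0))⁻¹)) hrow
  simp only [Matrix.vecMul_vecMul, Matrix.smul_vecMul, smul_smul] at h2
  rw [Matrix.mul_nonsing_inv _ ((Matrix.isUnit_iff_isUnit_det _).1 hu), Matrix.vecMul_one,
    _root_.zpow_neg, zpow_natCast, inv_mul_cancel₀ (pow_ne_zero _ hv), one_smul] at h2
  rw [← h2, _root_.zpow_neg, zpow_natCast]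
end
end

section
/- Suppose (A,B) is controllable, i.e. Ctr(A,B) is invertible. Then for every K ∈ ℝ^{1×n}, K = −eₙᵀ Ctr(A,B)^{-1} Δ(A), where Δ is the characteristic polynomial of A + BK. Consequently, for every monic real polynomial Δ of degree n there is exactly one K ∈ ℝ^{1×n} such that the characteristic polynomial of A + BK equals Δ, namely K = −eₙᵀ Ctr(A,B)^{-1} Δ(A) (Ackermann's formula). -/
open Matrix Polynomial

noncomputable section

/-- Ackermann's formula: the row vector `-eₙᵀ Ctr(A,B)⁻¹ Δ(A)`. -/
def ackermann (n : ℕ) (A : Matrix (Fin n) (Fin n) ℝ) (B : Fin n → ℝ) (hn : 1 ≤ n)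
    (Δ : ℝ[X]) : Fin n → ℝ :=
  -((Pi.single (⟨n - 1, by omega⟩ : Fin n) (1 : ℝ)) ᵥ*
      ((ctrM n A B)⁻¹ * Polynomial.aeval A Δ))

theorem vm_aeval {n : ℕ} (w : Fin n → ℝ) (M : Matrix (Fin n) (Fin n) ℝ) (q : ℝ[X]) :
    w ᵥ* (aeval M q) = ∑ i ∈ Finset.range (q.natDegree + 1), q.coeff i • (w ᵥ* M ^ i) := by
  rw [aeval_eq_sum_range, Matrix.vecMul_sum]
  exact Finset.sum_congr rfl fun i _ => by rw [Matrix.vecMul_smul]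

theorem vm_pow {n : ℕ} (A : Matrix (Fin n) (Fin n) ℝ) (B K w : Fin n → ℝ)
    (hw : ∀ j < n, w ⬝ᵥ (A ^ j *ᵥ B) = if j + 1 = n then 1 else 0) (j : ℕ) (hj : j < n) :
    w ᵥ* (A + vecMulVec B K) ^ j = w ᵥ* A ^ j ∧
    w ᵥ* (A + vecMulVec B K) ^ (j + 1) = w ᵥ* A ^ (j + 1) + (if j + 1 = n then (1 : ℝ) else 0) • K := by
  have step : ∀ j < n, w ᵥ* (A + vecMulVec B K) ^ j = w ᵥ* A ^ j →
      w ᵥ* (A + vecMulVec B K) ^ (j + 1)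
        = w ᵥ* A ^ (j + 1) + (if j + 1 = n then (1 : ℝ) else 0) • K := by
    intro j hj h
    rw [pow_succ, ← Matrix.vecMul_vecMul, h, Matrix.vecMul_add, Matrix.vecMul_vecMul, ← pow_succ,
      ← hw j hj, Matrix.dotProduct_mulVec]
    congr 1
    ext k
    simp [Matrix.vecMul, dotProduct, vecMulVec_apply, Finset.sum_mul, mul_assoc]
  induction j with
  | zero => exact ⟨by simp, step 0 hj (by simp)⟩
  | succ j ih =>
    have h := (ih (by omega)).2
    rw [if_neg (by omega), zero_smul, add_zero] at h
    exact ⟨h, step _ hj h⟩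

theorem vm_monic {n : ℕ} (hn : 1 ≤ n) (A : Matrix (Fin n) (Fin n) ℝ) (B K w : Fin n → ℝ)
    (hw : ∀ j < n, w ⬝ᵥ (A ^ j *ᵥ B) = if j + 1 = n then 1 else 0) (q : ℝ[X])
    (hq : q.Monic) (hd : q.natDegree = n) :
    w ᵥ* (aeval (A + vecMulVec B K) q) = w ᵥ* (aeval A q) + K := by
  have hc : q.coeff n = 1 := by rw [← hd]; exact hq
  rw [vm_aeval, vm_aeval, hd, Finset.sum_range_succ, Finset.sum_range_succ, hc]
  have h := (vm_pow A B K w hw (n - 1) (by omega)).2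
  rw [Nat.sub_add_cancel hn] at h
  rw [h, if_pos rfl, one_smul, one_smul, one_smul, ← add_assoc]
  congr 2
  exact Finset.sum_congr rfl fun i hi => by
    rw [(vm_pow A B K w hw i (Finset.mem_range.mp hi)).1]

theorem vm_zero {n : ℕ} (A : Matrix (Fin n) (Fin n) ℝ) (B w : Fin n → ℝ)
    (hw : ∀ j < n, w ⬝ᵥ (A ^ j *ᵥ B) = if j + 1 = n then 1 else 0) (p : ℝ[X])
    (hd : p.natDegree < n) (h : w ᵥ* (aeval A p) = 0) : p = 0 := by
  have h1 : (w ᵥ* (aeval A p)) ⬝ᵥ (A ^ (n - 1 - p.natDegree) *ᵥ B) = 0 := by rw [h]; simp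
  rw [vm_aeval, sum_dotProduct, Finset.sum_range_succ, Finset.sum_eq_zero, zero_add] at h1
  · rw [smul_dotProduct, ← Matrix.dotProduct_mulVec, Matrix.mulVec_mulVec, ← pow_add,
      hw _ (by omega), if_pos (by omega)] at h1
    simpa using h1
  · intro i hi
    have := Finset.mem_range.mp hi
    rw [smul_dotProduct, ← Matrix.dotProduct_mulVec, Matrix.mulVec_mulVec, ← pow_add,
      hw _ (by omega), if_neg (by omega), smul_zero]

theorem stmt3 (n : ℕ) (hn : 1 ≤ n) (A : Matrix (Fin n) (Fin n) ℝ) (B : Fin n → ℝ)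
    (hctr : IsUnit (ctrM n A B)) :
    -- every gain is given by Ackermann's formula applied to its closed-loop
    -- characteristic polynomial
    (∀ K : Fin n → ℝ,
      K = ackermann n A B hn (Matrix.charpoly (A + Matrix.vecMulVec B K))) ∧
    -- for every monic real polynomial `Δ` of degree `n` there is exactly one gain
    -- achieving `Δ` as closed-loop characteristic polynomial, namely Ackermann's formula
    (∀ Δ : ℝ[X], Δ.Monic → Δ.natDegree = n →
      Matrix.charpoly (A + Matrix.vecMulVec B (ackermann n A B hn Δ)) = Δ ∧
      ∀ K : Fin n → ℝ, Matrix.charpoly (A + Matrix.vecMulVec B K) = Δ →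
        K = ackermann n A B hn Δ) := by
  have hw : ∃ w : Fin n → ℝ, (∀ j < n, w ⬝ᵥ (A ^ j *ᵥ B) = if j + 1 = n then 1 else 0) ∧
      ∀ q, ackermann n A B hn q = -(w ᵥ* aeval A q) := by
    refine ⟨Pi.single (⟨n - 1, by omega⟩ : Fin n) (1 : ℝ) ᵥ* (ctrM n A B)⁻¹, ?_, ?_⟩
    · intro j hj
      have h : (Pi.single (⟨n - 1, by omega⟩ : Fin n) (1 : ℝ) ᵥ* (ctrM n A B)⁻¹) ᵥ* ctrM n A B
          = Pi.single (⟨n - 1, by omega⟩ : Fin n) (1 : ℝ) := by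
        rw [Matrix.vecMul_vecMul, Matrix.nonsing_inv_mul _ ((Matrix.isUnit_iff_isUnit_det _).mp hctr),
          Matrix.vecMul_one]
      have h2 := congrFun h ⟨j, hj⟩
      refine Eq.trans (Eq.trans ?_ h2) ?_
      · rfl
      · rw [Pi.single_apply]
        simp only [Fin.mk.injEq]
        exact if_congr (by omega) rfl rfl
    · intro q
      rw [ackermann, Matrix.vecMul_vecMul]
  obtain ⟨w, hw, hack⟩ := hw
  have part1 : ∀ K : Fin n → ℝ,
      K = ackermann n A B hn (Matrix.charpoly (A + Matrix.vecMulVec B K)) := by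
    intro K
    have h := vm_monic hn A B K w hw _ (Matrix.charpoly_monic (A + vecMulVec B K))
      (by simp [Matrix.charpoly_natDegree_eq_dim])
    rw [Matrix.aeval_self_charpoly, Matrix.vecMul_zero] at h
    rw [hack]
    exact (neg_eq_of_add_eq_zero_right h.symm).symm
  refine ⟨part1, fun Δ hΔ hd => ⟨?_, fun K hK => by rw [← hK]; exact part1 K⟩⟩
  have h := part1 (ackermann n A B hn Δ)
  set Q := Matrix.charpoly (A + vecMulVec B (ackermann n A B hn Δ)) with hQ
  have hQm : Q.Monic := Matrix.charpoly_monic _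
  have hQd : Q.natDegree = n := by simp [hQ, Matrix.charpoly_natDegree_eq_dim]
  rw [hack, hack, neg_inj] at h
  have hlt : (Q - Δ).natDegree < n := by
    have h1 : (Q - Δ).degree < Q.degree := degree_sub_lt
      (by rw [degree_eq_natDegree hQm.ne_zero, degree_eq_natDegree hΔ.ne_zero, hQd, hd])
      hQm.ne_zero (by rw [hQm.leadingCoeff, hΔ.leadingCoeff])
    rw [degree_eq_natDegree hQm.ne_zero, hQd] at h1
    by_cases h0 : Q - Δ = 0
    · rw [h0, natDegree_zero]; omega
    · exact (natDegree_lt_iff_degree_lt h0).mpr h1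
  refine sub_eq_zero.mp (vm_zero A B w hw _ hlt ?_)
  rw [map_sub, Matrix.vecMul_sub, h, sub_self]
end
end

section
/- For every K = (k₁,…,kₙ) ∈ ℝ^{1×n}, the characteristic polynomial of A + B₁K satisfies det(zI − A − B₁K) = zⁿ − (r + v kₙ) z^{n−1} + Σ_{j=0}^{n−2} v^{n−j−1} (r k_{j+2} − v k_{j+1}) z^{j}, as an identity of polynomials in z. -/
open Matrix Polynomial

noncomputable section

theorem det_aux {R : Type*} [CommRing R] (w : R) (m : ℕ) : ∀ (d c : ℕ → R),
    Matrix.det (Matrix.of fun i j : Fin (m + 1) =>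
      if (i : ℕ) = m then c j else if (j : ℕ) = i then d i
        else if (j : ℕ) = (i : ℕ) + 1 then -w else 0) =
      ∑ j ∈ Finset.range (m + 1), c j * w ^ (m - j) * ∏ i ∈ Finset.range j, d i := by
  induction m with
  | zero => intro d c; simp
  | succ m ih =>
    intro d c
    rw [Matrix.det_succ_column_zero, Fin.sum_univ_succ, Fin.sum_univ_castSucc]
    rw [Finset.sum_eq_zero]
    · have h1 := ih (fun i => d (i + 1)) (fun i => c (i + 1))
      have e1 : ((Matrix.of fun i j : Fin (m + 1 + 1) =>
          if (i : ℕ) = m + 1 then c j else if (j : ℕ) = i then d i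
          else if (j : ℕ) = (i : ℕ) + 1 then -w else 0).submatrix (Fin.succAbove 0) Fin.succ) =
          (Matrix.of fun i j : Fin (m + 1) =>
          if (i : ℕ) = m then c (j + 1) else if (j : ℕ) = i then d (i + 1)
          else if (j : ℕ) = (i : ℕ) + 1 then -w else 0) := by
        ext i j
        simp
      have e2 : ((Matrix.of fun i j : Fin (m + 1 + 1) =>
          if (i : ℕ) = m + 1 then c j else if (j : ℕ) = i then d i
          else if (j : ℕ) = (i : ℕ) + 1 then -w else 0).submatrix
            (Fin.succAbove (Fin.last m).succ) Fin.succ).det = (-w) ^ (m + 1) := by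
        rw [Matrix.det_of_isLowerTriangular]
        · rw [Finset.prod_congr rfl (g := fun _ => -w)]
          · simp
          · intro i _
            have := i.2
            simp [Fin.succAbove_last]
            omega
        · intro i j hij
          have := i.2
          have hij' : (i : ℕ) < j := by simpa using hij
          simp [Fin.succAbove_last]
          split_ifs <;> first | omega | rfl
      rw [e1, e2, h1, Finset.sum_range_succ' _ (m + 1)]
      simp only [Finset.prod_range_succ']
      have hs : (-1 : R) ^ (m + 1) * (-w) ^ (m + 1) = w ^ (m + 1) := by
        rw [← mul_pow]; simp
      simp [Finset.mul_sum]
      congr 1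
      · refine Finset.sum_congr rfl fun x _ => ?_
        ring
      · linear_combination c 0 * hs
    · intro i _
      have := i.2
      simp
      intro h
      omega

theorem stmt5 (n : ℕ) (hn : 2 ≤ n) (r v : ℝ) (K : Fin n → ℝ) :
    Matrix.charpoly (matA n r v + Matrix.vecMulVec (vecB n v 0) K) =
      X ^ n - C (r + v * K (⟨n - 1, by omega⟩ : Fin n)) * X ^ (n - 1) +
        ∑ j : Fin (n - 1),
          C (v ^ (n - (j : ℕ) - 1) *
              (r * K (⟨(j : ℕ) + 1, by omega⟩ : Fin n) -
                v * K (⟨(j : ℕ), by omega⟩ : Fin n))) *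
            X ^ (j : ℕ) := by
  obtain ⟨p, rfl⟩ : ∃ p, n = p + 1 + 1 := ⟨n - 2, by omega⟩
  obtain ⟨k, rfl⟩ : ∃ k : ℕ → ℝ, K = fun i : Fin (p + 1 + 1) => k (i : ℕ) :=
    ⟨fun j => if h : j < p + 1 + 1 then K ⟨j, h⟩ else 0, by ext i; have := i.2; simp; omega⟩
  have e := det_aux (C v) (p + 1) (fun i => if i = 0 then X - C r else X)
    (fun j => (if j = p + 1 then X else 0) - C v * C (k j))
  have hM : Matrix.charmatrix (matA (p+1+1) r v + Matrix.vecMulVec (vecB (p+1+1) v 0) fun i : Fin (p+1+1) => k (i : ℕ))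
      = (Matrix.of fun i j : Fin (p + 1 + 1) =>
      if (i : ℕ) = p + 1 then (if (j : ℕ) = p + 1 then X else 0) - C v * C (k j)
      else if (j : ℕ) = i then (if (i : ℕ) = 0 then X - C r else X)
        else if (j : ℕ) = (i : ℕ) + 1 then -C v else 0) := by
    ext1 i j
    have := i.2
    have := j.2
    rw [Matrix.charmatrix_apply, Matrix.diagonal_apply]
    simp only [Matrix.add_apply, matA, vecB, Matrix.of_apply, Matrix.vecMulVec_apply, Fin.ext_iff]
    split_ifs <;> first | omega | simp
  rw [Matrix.charpoly, hM, e]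
  rw [Finset.sum_range_succ' _ (p + 1), Finset.sum_range_succ]
  simp only [Finset.prod_range_succ']
  have h0 : (∑ j : Fin (p + 1 + 1 - 1), C (v ^ (p + 1 + 1 - (j : ℕ) - 1) *
              (r * k ((j : ℕ) + 1) - v * k (j : ℕ))) * X ^ (j : ℕ)) =
      ∑ j ∈ Finset.range (p + 1), C (v ^ (p + 1 - j) * (r * k (j + 1) - v * k j)) * X ^ j := by
    rw [Finset.sum_range]
    refine Finset.sum_congr rfl fun j _ => ?_
    rw [show p + 1 + 1 - (j : ℕ) - 1 = p + 1 - j by omega]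
  rw [h0]
  have h1 : ∑ j ∈ Finset.range (p + 1), C (v ^ (p + 1 - j) * (r * k (j + 1) - v * k j)) * X ^ j
     = ∑ j ∈ Finset.range (p + 1), C (v ^ (p + 1 - j) * (r * k (j + 1))) * X ^ j
     - ∑ j ∈ Finset.range (p + 1), C (v ^ (p + 1 - j) * (v * k j)) * X ^ j := by
    rw [← Finset.sum_sub_distrib]
    refine Finset.sum_congr rfl fun j _ => ?_
    simp only [map_mul, map_sub]; ring
  rw [h1, Finset.sum_range_succ, Finset.sum_range_succ']
  simp only [if_true]
  have h2 : ∀ j ∈ Finset.range p,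
     ((if j + 1 = p + 1 then (X : ℝ[X]) else 0) - C v * C (k (j + 1))) * C v ^ (p + 1 - (j + 1)) *
      ((∏ i ∈ Finset.range j, if i + 1 = 0 then X - C r else X) * (X - C r))
     = C (v ^ (p + 1 - j) * (r * k (j + 1))) * X ^ j
      - C (v ^ (p + 1 - (j + 1)) * (v * k (j + 1))) * X ^ (j + 1) := by
    intro j hj
    have hj' := Finset.mem_range.1 hj
    obtain ⟨q, rfl⟩ : ∃ q, p = j + 1 + q := ⟨p - (j + 1), by omega⟩
    rw [if_neg (by omega), show j + 1 + q + 1 - (j + 1) = q + 1 by omega,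
      show j + 1 + q + 1 - j = q + 2 by omega]
    simp
    ring
  rw [Finset.sum_congr rfl h2, Finset.sum_sub_distrib]
  simp
  ring
end
end

section
/- For every K = (k₁,…,kₙ) ∈ ℝ^{1×n} and every m ∈ ℝ, det(zI − A − B₂K) = det(zI − A − B₁K) − m k₁ z^{n−1}, as an identity of polynomials in z; that is, the characteristic polynomial of A + B₂K equals that of A + B₁K minus m k₁ z^{n−1}. -/
open Matrix Polynomial

noncomputable section

theorem stmt6 (n : ℕ) (hn : 2 ≤ n) (r v : ℝ) (K : Fin n → ℝ) (m : ℝ) :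
    Matrix.charpoly (matA n r v + Matrix.vecMulVec (vecB n v m) K) =
      Matrix.charpoly (matA n r v + Matrix.vecMulVec (vecB n v 0) K) -
        C (m * K (⟨0, by omega⟩ : Fin n)) * X ^ (n - 1) := by
  obtain ⟨k, rfl⟩ : ∃ k, n = k + 1 := ⟨n - 1, by omega⟩
  have h0 : (⟨0, by omega⟩ : Fin (k + 1)) = 0 := rfl
  rw [h0]
  set M0 := charmatrix (matA (k + 1) r v + Matrix.vecMulVec (vecB (k + 1) v 0) K) with hM0
  set P : Matrix (Fin (k + 1)) (Fin (k + 1)) ℝ[X] :=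
    (charmatrix (matA (k + 1) r v)).updateRow 0 (fun j => C (K j)) with hP
  have hPdet : P.det = C (K 0) * X ^ k := by
    rw [Matrix.det_of_upperTriangular, Fin.prod_univ_succ]
    · have h1 : P 0 0 = C (K 0) := by simp [hP]
      have h2 : ∀ i : Fin k, P i.succ i.succ = X := by
        intro i
        rw [hP, Matrix.updateRow_ne (Fin.succ_ne_zero i), charmatrix_apply_eq]
        simp [matA]
      rw [h1]
      simp [h2]
    · intro i j hij
      have hij' : j < i := hij
      have hi : i ≠ 0 := by
        rintro rfl
        exact absurd hij' (by simp)
      have h3 : (i : ℕ) ≠ 0 := fun h => hi (Fin.ext h)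
      have h4 : (j : ℕ) < i := hij'
      rw [hP, Matrix.updateRow_ne hi, charmatrix_apply_ne _ _ _ hij'.ne']
      have h5 : (j : ℕ) ≠ i + 1 := by omega
      simp [matA, hi, h5]
  have hQ : (M0.updateRow 0 (fun j => C (K j))).det = P.det := by
    apply Matrix.det_eq_of_forall_row_eq_smul_add_const
      (fun i => if i = 0 then 0 else - C (vecB (k + 1) v 0 i)) 0 (by simp)
    intro i j
    by_cases hi : i = 0
    · subst hi
      simp [hP]
    · simp only [hP, hM0, Matrix.updateRow_ne hi, Matrix.updateRow_self, if_neg hi,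
        charmatrix_apply, Matrix.add_apply, Matrix.vecMulVec_apply, C_add, C_mul]
      ring
  have hM : charmatrix (matA (k + 1) r v + Matrix.vecMulVec (vecB (k + 1) v m) K) =
      M0.updateRow 0 (M0 0 + (-C m) • (fun j => C (K j))) := by
    ext1 i j
    by_cases hi : i = 0
    · subst hi
      simp only [hM0, Matrix.updateRow_self, Pi.add_apply, Pi.smul_apply, smul_eq_mul,
        charmatrix_apply, Matrix.add_apply, Matrix.vecMulVec_apply, C_add, C_mul]
      simp [vecB]
      ring
    · have h3 : (i : ℕ) ≠ 0 := fun h => hi (Fin.ext h)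
      simp only [hM0, Matrix.updateRow_ne hi,
        charmatrix_apply, Matrix.add_apply, Matrix.vecMulVec_apply, vecB, if_neg h3]
  rw [Matrix.charpoly, hM, Matrix.det_updateRow_add, Matrix.det_updateRow_smul, hQ, hPdet,
    Matrix.updateRow_eq_self, Matrix.charpoly, ← hM0, Nat.add_sub_cancel, C_mul]
  ring
end
end

section
/- Assume r > 0 and v > 0. For every b ∈ ℝ, the controllability matrix Ctr(A, B(b)) is invertible if and only if b ≠ −vⁿ/r^{n−1}. In particular, (A, B(b)) is controllable for every b ≥ 0, and (A, B(b)) is uncontrollable when b = −vⁿ/r^{n−1}. -/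
open Matrix

noncomputable section

lemma matA_mulVec (m : ℕ) (r v : ℝ) (x : Fin (m+2) → ℝ) (i : Fin (m+2)) :
    (matA (m+2) r v *ᵥ x) i = (if (i:ℕ) = 0 then r * x 0 else 0) +
      (if h : (i:ℕ) + 1 < m + 2 then v * x ⟨i+1, h⟩ else 0) := by
  have key : ∀ j : Fin (m+2), matA (m+2) r v i j * x j =
      (if j = 0 then (if (i:ℕ) = 0 then r * x 0 else 0) else 0) +
      (if h : (i:ℕ) + 1 < m + 2 then (if j = ⟨i+1, h⟩ then v * x ⟨i+1, h⟩ else 0) else 0) := by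
    intro j
    simp only [matA, Matrix.of_apply]
    by_cases hj : j = 0
    · subst hj
      have : ∀ h : (i:ℕ) + 1 < m + 2, (0 : Fin (m+2)) ≠ ⟨i+1, h⟩ := by
        intro h h'; simpa using congrArg Fin.val h'
      by_cases hi : (i:ℕ) = 0 <;> simp [hi, this]
    · have hj' : (j:ℕ) ≠ 0 := fun h => hj (Fin.ext h)
      by_cases hij : (j:ℕ) = i + 1
      · have h : (i:ℕ) + 1 < m + 2 := hij ▸ j.2
        have hje : j = ⟨i+1, h⟩ := Fin.ext hij
        rw [dif_pos h, if_pos hje, if_neg hj, if_neg (by simp [hj']), if_pos hij, hje]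
        simp
      · have : ∀ h : (i:ℕ) + 1 < m + 2, j ≠ ⟨i+1, h⟩ := by
          intro h h'; exact hij (congrArg Fin.val h')
        simp [hj, hj', hij, this]
  rw [Matrix.mulVec, dotProduct, Finset.sum_congr rfl (fun j _ => key j), Finset.sum_add_distrib]
  congr 1
  · simp
  · by_cases h : (i:ℕ) + 1 < m + 2 <;> simp [h]

lemma pow_entry (m : ℕ) (r v b : ℝ) (j : ℕ) (hj : j ≤ m + 1) :
    ∀ i : Fin (m+2), ((matA (m+2) r v ^ j) *ᵥ vecB (m+2) v b) i =
      if (i:ℕ) = 0 then r ^ j * b + (if j = m + 1 then v ^ (m+2) else 0)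
      else if (i:ℕ) + j = m + 1 then v ^ (j+1) else 0 := by
  induction j with
  | zero => intro i; simp [vecB]
  | succ j ih =>
    intro i
    have ih := ih (by omega)
    rw [pow_succ', ← Matrix.mulVec_mulVec, matA_mulVec]
    simp only [ih]
    by_cases hi : (i:ℕ) = 0
    · by_cases hjm : j = m
      · subst hjm; simp [hi, add_comm 1]; ring
      · have h2 : ¬ (1 + j = m + 1) := by omega
        have h3 : ¬ (j = m + 1) := by omega
        simp [hi, hjm, h2, h3]; ring
    · by_cases h : (i:ℕ) + 1 < m + 2
      · by_cases h2 : (i:ℕ) + 1 + j = m + 1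
        · have h3 : (i:ℕ) + (j + 1) = m + 1 := by omega
          rw [if_neg hi, dif_pos h, if_neg hi, if_pos h3, if_neg (by simp), if_pos h2]; ring
        · have h3 : ¬ ((i:ℕ) + (j + 1) = m + 1) := by omega
          rw [if_neg hi, dif_pos h, if_neg hi, if_neg h3, if_neg (by simp), if_neg h2]; ring
      · have h3 : ¬ ((i:ℕ) + (j + 1) = m + 1) := by omega
        rw [if_neg hi, dif_neg h, if_neg hi, if_neg h3]; ring

lemma unit_iff (m : ℕ) (r v b : ℝ) (hv : 0 < v) :
    IsUnit (ctrM (m+2) (matA (m+2) r v) (vecB (m+2) v b)) ↔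
      r ^ (m+1) * b + v ^ (m+2) ≠ 0 := by
  have ent : ∀ i j, ctrM (m+2) (matA (m+2) r v) (vecB (m+2) v b) i j =
      if (i:ℕ) = 0 then r ^ (j:ℕ) * b + (if (j:ℕ) = m + 1 then v ^ (m+2) else 0)
      else if (i:ℕ) + j = m + 1 then v ^ ((j:ℕ)+1) else 0 := fun i j =>
    pow_entry m r v b j (by omega) i
  rw [Matrix.isUnit_iff_isUnit_det, isUnit_iff_ne_zero]
  constructor
  · intro h h0
    apply h
    apply Matrix.det_eq_zero_of_column_eq_zero (Fin.last (m+1))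
    intro i
    rw [ent]
    by_cases hi : (i:ℕ) = 0
    · simp [hi, h0]
    · simp [hi]
  · intro hc hdet
    obtain ⟨x, hx, hMx⟩ := Matrix.exists_mulVec_eq_zero_iff.mpr hdet
    apply hx
    have h1 : ∀ k : Fin (m+2), k ≠ Fin.last (m+1) → x k = 0 := by
      intro k hk
      have hk' : (k:ℕ) < m + 1 := by
        have : (k:ℕ) ≠ m + 1 := fun h => hk (Fin.ext h)
        omega
      have := congrFun hMx ⟨m + 1 - k, by omega⟩
      rw [Matrix.mulVec, dotProduct, Finset.sum_eq_single k] at this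
      · rw [ent, if_neg (by simp; omega), if_pos (by simp; omega)] at this
        exact (mul_eq_zero.mp this).resolve_left (by positivity)
      · intro j _ hjk
        have : (j:ℕ) ≠ k := fun h => hjk (Fin.ext h)
        rw [ent, if_neg (by simp; omega), if_neg (by simp; omega), zero_mul]
      · simp
    have h2 : x (Fin.last (m+1)) = 0 := by
      have := congrFun hMx 0
      rw [Matrix.mulVec, dotProduct, Finset.sum_eq_single (Fin.last (m+1))] at this
      · rw [ent] at this
        simp only [Fin.val_zero, Fin.val_last, if_true] at this
        exact (mul_eq_zero.mp this).resolve_left hc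
      · intro j _ hj
        rw [h1 j hj, mul_zero]
      · simp
    funext k
    by_cases hk : k = Fin.last (m+1)
    · rw [hk, h2]; rfl
    · rw [h1 k hk]; rfl

theorem stmt11 (n : ℕ) (hn : 2 ≤ n) (r v : ℝ) (hr : 0 < r) (hv : 0 < v) :
    (∀ b : ℝ,
      IsUnit (ctrM n (matA n r v) (vecB n v b)) ↔ b ≠ -(v ^ n) / r ^ (n - 1)) ∧
    (∀ b : ℝ, 0 ≤ b → IsUnit (ctrM n (matA n r v) (vecB n v b))) ∧
    ¬ IsUnit (ctrM n (matA n r v) (vecB n v (-(v ^ n) / r ^ (n - 1)))) := by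
  obtain ⟨m, rfl⟩ : ∃ m, n = m + 2 := ⟨n - 2, by omega⟩
  have main : ∀ b : ℝ, IsUnit (ctrM (m+2) (matA (m+2) r v) (vecB (m+2) v b)) ↔
      b ≠ -(v ^ (m+2)) / r ^ (m + 2 - 1) := by
    intro b
    rw [unit_iff m r v b hv, show m + 2 - 1 = m + 1 from rfl, not_iff_not,
      eq_div_iff (by positivity)]
    constructor <;> intro h <;> linarith
  refine ⟨main, fun b hb => ?_, fun h => (main _).mp h rfl⟩
  rw [unit_iff m r v b hv]
  positivity
end
end

section
/- For any m ∈ ℝ, KL(P₁, P₂) = Σ_{t=0}^{N−1} m² u_t²/(2σ_w²). In particular, if σ_u > 0 and u_t² ≤ σ_u² for all 0 ≤ t ≤ N−1, then KL(P₁, P₂) ≤ N m² σ_u²/(2σ_w²). -/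
open Matrix MeasureTheory ProbabilityTheory
open scoped ENNReal NNReal

noncomputable section

open Classical in
/-- Kullback–Leibler divergence `KL(P,Q) = ∫ log(dP/dQ) dP ∈ [0,∞]`, set to `∞`
when `P` is not absolutely continuous with respect to `Q`. -/
def klDiv {Ω : Type*} [MeasurableSpace Ω] (P Q : Measure Ω) : ℝ≥0∞ :=
  if P ≪ Q then ENNReal.ofReal (∫ x, Real.log (P.rnDeriv Q x).toReal ∂P) else ⊤

/-- The state trajectory: `x₀ = 0`, `x_{t+1} = A x_t + B u_t + w_t`. -/
def traj {n : ℕ} (A : Matrix (Fin n) (Fin n) ℝ) (B : Fin n → ℝ) (u : ℕ → ℝ)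
    (w : ℕ → Fin n → ℝ) : ℕ → Fin n → ℝ
  | 0 => 0
  | t + 1 => A *ᵥ traj A B u w t + u t • B + w t

/-- The map `T_{(A,B)}` sending the noise sequence `(w₀, …, w_{N-1})` to the state
trajectory `(x₁, …, x_N)`. -/
def trajMap {n : ℕ} (N : ℕ) (A : Matrix (Fin n) (Fin n) ℝ) (B : Fin n → ℝ)
    (u : ℕ → ℝ) : (Fin N → Fin n → ℝ) → (Fin N → Fin n → ℝ) :=
  fun w t => traj A B u (fun s => if h : s < N then w ⟨s, h⟩ else 0) ((t : ℕ) + 1)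

lemma tilt_pi {ι : Type*} [Fintype ι] {X : ι → Type*} [∀ i, MeasurableSpace (X i)]
    (μ ν : ∀ i, Measure (X i)) [∀ i, IsProbabilityMeasure (μ i)] [∀ i, IsProbabilityMeasure (ν i)]
    (l : ∀ i, X i → ℝ) (hl : ∀ i, Measurable (l i))
    (h : ∀ i, μ i = (ν i).withDensity (fun x => ENNReal.ofReal (Real.exp (l i x)))) :
    Measure.pi μ = (Measure.pi ν).withDensity
      (fun x => ENNReal.ofReal (Real.exp (∑ i, l i (x i)))) := by
  refine Measure.pi_eq fun s hs => ?_
  rw [withDensity_apply _ (MeasurableSet.univ_pi hs),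
    ← lintegral_indicator (MeasurableSet.univ_pi hs)]
  have key : ∀ x : ∀ i, X i, (Set.univ.pi s).indicator
      (fun x => ENNReal.ofReal (Real.exp (∑ i, l i (x i)))) x =
      ∏ i, (s i).indicator (fun y => ENNReal.ofReal (Real.exp (l i y))) (x i) := by
    intro x
    by_cases hx : x ∈ Set.univ.pi s
    · rw [Set.indicator_of_mem hx, Real.exp_sum, ENNReal.ofReal_prod_of_nonneg
        (fun i _ => (Real.exp_pos _).le)]
      refine Finset.prod_congr rfl fun i _ => ?_
      rw [Set.indicator_of_mem (hx i trivial)]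
    · rw [Set.indicator_of_notMem hx]
      simp only [Set.mem_univ_pi, not_forall] at hx
      obtain ⟨i, hi⟩ := hx
      exact (Finset.prod_eq_zero (Finset.mem_univ i) (Set.indicator_of_notMem hi _)).symm
  have hm : ∀ i, Measurable ((s i).indicator (fun y => ENNReal.ofReal (Real.exp (l i y)))) :=
    fun i => ((hl i).exp.ennreal_ofReal).indicator (hs i)
  rw [lintegral_congr key, lintegral_prod_eq_prod_lintegral_of_indepFun (μ := Measure.pi ν)
    Finset.univ
    (fun i (x : ∀ i, X i) => (s i).indicator (fun y => ENNReal.ofReal (Real.exp (l i y))) (x i))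
    (iIndepFun_pi fun i => (hm i).aemeasurable) (fun i => (hm i).comp (measurable_pi_apply i))]
  refine Finset.prod_congr rfl fun i _ => ?_
  rw [(measurePreserving_eval ν i).lintegral_comp (hm i), lintegral_indicator (hs i), h i,
    withDensity_apply _ (hs i)]

lemma tilt_gauss (c : ℝ) (s : ℝ≥0) (hs : s ≠ 0) :
    gaussianReal 0 s = ((gaussianReal 0 s).map (fun x => x + c)).withDensity
      (fun x => ENNReal.ofReal (Real.exp ((c ^ 2 - 2 * c * x) / (2 * s)))) := by
  rw [gaussianReal_map_add_const, zero_add, gaussianReal_of_var_ne_zero _ hs,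
    gaussianReal_of_var_ne_zero _ hs, ← withDensity_mul _ (measurable_gaussianPDF _ _) (by fun_prop)]
  congr 1
  ext x
  simp only [Pi.mul_apply, gaussianPDF_def, gaussianPDFReal_def]
  rw [← ENNReal.ofReal_mul (by positivity), mul_assoc _ (Real.exp _), ← Real.exp_add]
  congr 3
  have : (s : ℝ) ≠ 0 := by exact_mod_cast hs
  field_simp
  ring

lemma kl_general {Ω Ω' : Type*} [MeasurableSpace Ω] [MeasurableSpace Ω'] (μ ν : Measure Ω)
    [IsProbabilityMeasure μ] [IsProbabilityMeasure ν] (l : Ω → ℝ) (hl : Measurable l)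
    (h : μ = ν.withDensity (fun x => ENNReal.ofReal (Real.exp (l x))))
    (T : Ω → Ω') (S : Ω' → Ω) (hT : Measurable T) (hS : Measurable S) (hST : ∀ x, S (T x) = x) :
    klDiv (μ.map T) (ν.map T) = ENNReal.ofReal (∫ x, l x ∂μ) := by
  have hf : Measurable (fun y => ENNReal.ofReal (Real.exp (l (S y)))) := by fun_prop
  have h1 : μ.map T = (ν.map T).withDensity (fun y => ENNReal.ofReal (Real.exp (l (S y)))) := by
    ext s hs
    rw [Measure.map_apply hT hs, withDensity_apply _ hs, setLIntegral_map hs hf hT, h,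
      withDensity_apply _ (hT hs)]
    simp only [hST]
  have : IsProbabilityMeasure (ν.map T) := Measure.isProbabilityMeasure_map hT.aemeasurable
  have hac : μ.map T ≪ ν.map T := by rw [h1]; exact withDensity_absolutelyContinuous _ _
  have h2 := Measure.rnDeriv_withDensity (ν.map T) hf
  rw [← h1] at h2
  rw [klDiv, if_pos hac]
  congr 1
  have h3 : (fun x => Real.log ((μ.map T).rnDeriv (ν.map T) x).toReal) =ᵐ[μ.map T]
      fun y => l (S y) := by
    filter_upwards [hac.ae_le h2] with y hy
    rw [hy, ENNReal.toReal_ofReal (Real.exp_pos _).le, Real.log_exp]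
  rw [integral_congr_ae h3, integral_map (f := fun y => l (S y)) hT.aemeasurable (hl.comp hS).aestronglyMeasurable]
  simp only [hST]

def invMap {n : ℕ} (N : ℕ) (A : Matrix (Fin n) (Fin n) ℝ) (B : Fin n → ℝ)
    (u : ℕ → ℝ) : (Fin N → Fin n → ℝ) → (Fin N → Fin n → ℝ) :=
  fun x t => x t - A *ᵥ (if h : (t : ℕ) = 0 then 0 else x ⟨(t : ℕ) - 1, by omega⟩) - u t • B

lemma invMap_trajMap {n : ℕ} (N : ℕ) (A : Matrix (Fin n) (Fin n) ℝ) (B : Fin n → ℝ)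
    (u : ℕ → ℝ) (w : Fin N → Fin n → ℝ) : invMap N A B u (trajMap N A B u w) = w := by
  funext ⟨t, ht⟩
  cases t with
  | zero => simp [invMap, trajMap, traj, ht]
  | succ t =>
    simp only [invMap, trajMap, Nat.add_sub_cancel, Nat.succ_ne_zero, dif_neg, not_false_eq_true]
    rw [traj, dif_pos ht]
    abel

lemma measurable_invMap {n : ℕ} (N : ℕ) (A : Matrix (Fin n) (Fin n) ℝ) (B : Fin n → ℝ)
    (u : ℕ → ℝ) : Measurable (invMap N A B u) := by
  refine Continuous.measurable (continuous_pi fun t => ?_)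
  unfold invMap
  split_ifs <;> fun_prop

lemma measurable_trajMap {n : ℕ} (N : ℕ) (A : Matrix (Fin n) (Fin n) ℝ) (B : Fin n → ℝ)
    (u : ℕ → ℝ) : Measurable (trajMap N A B u) := by
  have : ∀ t, Continuous (fun w : Fin N → Fin n → ℝ =>
      traj A B u (fun s => if h : s < N then w ⟨s, h⟩ else 0) t) := by
    intro t
    induction t with
    | zero => simp only [traj]; fun_prop
    | succ t ih =>
      simp only [traj]
      split_ifs <;> fun_prop
  exact (continuous_pi fun t => this _).measurable

lemma traj_shift {n : ℕ} (N : ℕ) (A : Matrix (Fin n) (Fin n) ℝ) (B B' : Fin n → ℝ)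
    (u : ℕ → ℝ) (w : Fin N → Fin n → ℝ) : trajMap N A B' u w =
      trajMap N A B u (fun t i => w t i + u t * (B' i - B i)) := by
  have : ∀ t, t ≤ N → traj A B' u (fun s => if h : s < N then w ⟨s, h⟩ else 0) t =
      traj A B u (fun s => if h : s < N then (fun i => w ⟨s, h⟩ i + u s * (B' i - B i)) else 0) t := by
    intro t
    induction t with
    | zero => intro; rfl
    | succ t ih =>
      intro ht
      rw [traj, traj, ih (by omega), dif_pos (show t < N by omega), dif_pos (show t < N by omega)]
      ext i
      simp only [Pi.add_apply, Pi.smul_apply, smul_eq_mul]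
      ring
  funext t
  exact this _ t.2

lemma integral_tilt (c : ℝ) (s : ℝ≥0) :
    Integrable (fun x : ℝ => (c ^ 2 - 2 * c * x) / (2 * s)) (gaussianReal 0 s) ∧
    ∫ x : ℝ, (c ^ 2 - 2 * c * x) / (2 * s) ∂(gaussianReal 0 s) = c ^ 2 / (2 * s) := by
  have hi : Integrable (fun x : ℝ => x) (gaussianReal 0 s) :=
    (memLp_id_gaussianReal' 1 (by simp)).integrable le_rfl
  refine ⟨((integrable_const _).sub (hi.const_mul _)).div_const _, ?_⟩
  rw [integral_div, integral_sub (integrable_const _) (hi.const_mul _), integral_const_mul,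
    integral_id_gaussianReal]
  simp

lemma map_shift (n N : ℕ) (s : ℝ≥0) (c : Fin N → Fin n → ℝ) :
    (Measure.pi fun _ : Fin N => Measure.pi fun _ : Fin n => gaussianReal 0 s).map
      (fun w t i => w t i + c t i) = Measure.pi fun t : Fin N => Measure.pi fun i : Fin n =>
        (gaussianReal 0 s).map (fun x => x + c t i) := by
  have hp : ∀ c : ℝ, IsProbabilityMeasure ((gaussianReal 0 s).map (fun x => x + c)) :=
    fun c => Measure.isProbabilityMeasure_map (by fun_prop)
  have hmc : ∀ t, Measurable (fun (x : Fin n → ℝ) i => x i + c t i) := fun t => by fun_prop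
  have e3 : ∀ t, (Measure.pi fun _ : Fin n => gaussianReal 0 s).map (fun x i => x i + c t i) =
      Measure.pi fun i : Fin n => (gaussianReal 0 s).map (fun x => x + c t i) := fun t =>
    Measure.pi_map_pi (f := fun i x => x + c t i) (fun i => by fun_prop)
  have (t : Fin N) : IsProbabilityMeasure
      ((Measure.pi fun _ : Fin n => gaussianReal 0 s).map (fun x i => x i + c t i)) :=
    Measure.isProbabilityMeasure_map (hmc t).aemeasurable
  simp only [← e3]
  exact Measure.pi_map_pi (μ := fun _ : Fin N => Measure.pi fun _ : Fin n => gaussianReal 0 s)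
    (f := fun t x i => x i + c t i) (fun t => (hmc t).aemeasurable)

lemma tilt_shift (n N : ℕ) (s : ℝ≥0) (hs : s ≠ 0) (c : Fin N → Fin n → ℝ) :
    (Measure.pi fun _ : Fin N => Measure.pi fun _ : Fin n => gaussianReal 0 s) =
     (Measure.pi fun t : Fin N => Measure.pi fun i : Fin n =>
        (gaussianReal 0 s).map (fun x => x + c t i)).withDensity
      (fun w => ENNReal.ofReal (Real.exp
        (∑ t, ∑ i, (c t i ^ 2 - 2 * c t i * w t i) / (2 * s)))) := by
  have hp : ∀ c : ℝ, IsProbabilityMeasure ((gaussianReal 0 s).map (fun x => x + c)) :=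
    fun c => Measure.isProbabilityMeasure_map (by fun_prop)
  have h1 : ∀ t, (Measure.pi fun _ : Fin n => gaussianReal 0 s) =
     (Measure.pi fun i : Fin n => (gaussianReal 0 s).map (fun x => x + c t i)).withDensity
      (fun w => ENNReal.ofReal (Real.exp (∑ i, (c t i ^ 2 - 2 * c t i * w i) / (2 * s)))) :=
    fun t => tilt_pi (fun _ : Fin n => gaussianReal 0 s)
      (fun i : Fin n => (gaussianReal 0 s).map (fun x => x + c t i))
      (fun i x => (c t i ^ 2 - 2 * c t i * x) / (2 * s))
      (fun i => by fun_prop) (fun i => tilt_gauss (c t i) s hs)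
  exact tilt_pi (fun _ : Fin N => Measure.pi fun _ : Fin n => gaussianReal 0 s)
    (fun t : Fin N => Measure.pi fun i : Fin n => (gaussianReal 0 s).map (fun x => x + c t i))
    (fun t x => ∑ i, (c t i ^ 2 - 2 * c t i * x i) / (2 * s)) (fun t => by fun_prop) h1

lemma integral_shift (n N : ℕ) (s : ℝ≥0) (c : Fin N → Fin n → ℝ) :
    ∫ w, (∑ t, ∑ i, (c t i ^ 2 - 2 * c t i * w t i) / (2 * s))
      ∂(Measure.pi fun _ : Fin N => Measure.pi fun _ : Fin n => gaussianReal 0 s) =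
      ∑ t, ∑ i, c t i ^ 2 / (2 * s) := by
  have hi1 : ∀ t i, Integrable (fun x : Fin n → ℝ => (c t i ^ 2 - 2 * c t i * x i) / (2 * s))
      (Measure.pi fun _ : Fin n => gaussianReal 0 s) := fun t i =>
    integrable_comp_eval (μ := fun _ : Fin n => gaussianReal 0 s)
      (f := fun x => (c t i ^ 2 - 2 * c t i * x) / (2 * s)) (integral_tilt (c t i) s).1
  have hi2 : ∀ t, Integrable (fun x : Fin n → ℝ => ∑ i, (c t i ^ 2 - 2 * c t i * x i) / (2 * s))
      (Measure.pi fun _ : Fin n => gaussianReal 0 s) := fun t =>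
    integrable_finset_sum _ fun i _ => hi1 t i
  rw [integral_finset_sum _ (fun t _ => integrable_comp_eval
    (μ := fun _ : Fin N => Measure.pi fun _ : Fin n => gaussianReal 0 s) (hi2 t))]
  refine Finset.sum_congr rfl fun t _ => ?_
  rw [integral_comp_eval (μ := fun _ : Fin N => Measure.pi fun _ : Fin n => gaussianReal 0 s)
    (f := fun x : Fin n → ℝ => ∑ i, (c t i ^ 2 - 2 * c t i * x i) / (2 * s)) (hi2 t).1,
    integral_finset_sum _ (fun i _ => hi1 t i)]
  have : ∀ i, ∫ x : Fin n → ℝ, (c t i ^ 2 - 2 * c t i * x i) / (2 * s)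
      ∂(Measure.pi fun _ : Fin n => gaussianReal 0 s) = c t i ^ 2 / (2 * s) := fun i => by
    rw [integral_comp_eval (μ := fun _ : Fin n => gaussianReal 0 s)
      (f := fun x => (c t i ^ 2 - 2 * c t i * x) / (2 * s)) (integral_tilt (c t i) s).1.1,
      (integral_tilt (c t i) s).2]
  simp only [this]

lemma kl_eq (n : ℕ) (hn : 2 ≤ n) (r v m : ℝ) (N : ℕ)
    (s : ℝ≥0) (hs : s ≠ 0) (u : ℕ → ℝ) :
    klDiv
        ((Measure.pi fun _ : Fin N =>
            Measure.pi fun _ : Fin n => gaussianReal 0 s).map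
          (trajMap N (matA n r v) (vecB n v 0) u))
        ((Measure.pi fun _ : Fin N =>
            Measure.pi fun _ : Fin n => gaussianReal 0 s).map
          (trajMap N (matA n r v) (vecB n v m) u)) =
      ENNReal.ofReal (∑ t ∈ Finset.range N, m ^ 2 * u t ^ 2 / (2 * s)) := by
  have hT := measurable_trajMap N (matA n r v) (vecB n v 0) u
  have hp : ∀ c : ℝ, IsProbabilityMeasure ((gaussianReal 0 s).map (fun x => x + c)) :=
    fun c => Measure.isProbabilityMeasure_map (by fun_prop)
  obtain ⟨c, hc⟩ : ∃ c : Fin N → Fin n → ℝ,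
    c = fun (t : Fin N) i => u t * (vecB n v m i - vecB n v 0 i) := ⟨_, rfl⟩
  have e : trajMap N (matA n r v) (vecB n v m) u =
      trajMap N (matA n r v) (vecB n v 0) u ∘ (fun w t i => w t i + c t i) := by
    funext w; rw [hc]; exact traj_shift N _ _ _ u w
  rw [e, ← Measure.map_map hT (by fun_prop), map_shift,
    kl_general _ _ _ (by fun_prop) (tilt_shift n N s hs c) _ _ hT (measurable_invMap N _ _ u)
      (invMap_trajMap N _ _ u), integral_shift, Finset.sum_range]
  congr 1
  refine Finset.sum_congr rfl fun t _ => ?_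
  rw [Finset.sum_eq_single (⟨0, by omega⟩ : Fin n)]
  · simp [hc, vecB]; ring
  · intro i _ hi
    have : (i : ℕ) ≠ 0 := fun h => hi (Fin.ext h)
    simp [hc, vecB, this]
  · simp

theorem stmt13 (n : ℕ) (hn : 2 ≤ n) (r v m : ℝ) (N : ℕ) (hN : 1 ≤ N)
    (σw : ℝ) (hσw : 0 < σw) (u : ℕ → ℝ) :
    klDiv
        ((Measure.pi fun _ : Fin N =>
            Measure.pi fun _ : Fin n => gaussianReal 0 ⟨σw ^ 2, sq_nonneg σw⟩).map
          (trajMap N (matA n r v) (vecB n v 0) u))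
        ((Measure.pi fun _ : Fin N =>
            Measure.pi fun _ : Fin n => gaussianReal 0 ⟨σw ^ 2, sq_nonneg σw⟩).map
          (trajMap N (matA n r v) (vecB n v m) u)) =
      ENNReal.ofReal (∑ t ∈ Finset.range N, m ^ 2 * u t ^ 2 / (2 * σw ^ 2)) ∧
    ∀ σu : ℝ, 0 < σu → (∀ t < N, u t ^ 2 ≤ σu ^ 2) →
      klDiv
          ((Measure.pi fun _ : Fin N =>
              Measure.pi fun _ : Fin n => gaussianReal 0 ⟨σw ^ 2, sq_nonneg σw⟩).map
            (trajMap N (matA n r v) (vecB n v 0) u))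
          ((Measure.pi fun _ : Fin N =>
              Measure.pi fun _ : Fin n => gaussianReal 0 ⟨σw ^ 2, sq_nonneg σw⟩).map
            (trajMap N (matA n r v) (vecB n v m) u)) ≤
        ENNReal.ofReal ((N : ℝ) * m ^ 2 * σu ^ 2 / (2 * σw ^ 2)) := by
  have hs : (⟨σw ^ 2, sq_nonneg σw⟩ : ℝ≥0) ≠ 0 := by
    intro h
    have h2 : σw ^ 2 = 0 := congrArg NNReal.toReal h
    exact (pow_pos hσw 2).ne' h2
  have key : _ = ENNReal.ofReal (∑ t ∈ Finset.range N, m ^ 2 * u t ^ 2 / (2 * σw ^ 2)) :=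
    kl_eq n hn r v m N ⟨σw ^ 2, sq_nonneg σw⟩ hs u
  refine ⟨key, fun σu _ hu => ?_⟩
  rw [key]
  refine ENNReal.ofReal_le_ofReal ?_
  calc _ ≤ ∑ t ∈ Finset.range N, m ^ 2 * σu ^ 2 / (2 * σw ^ 2) := by
        refine Finset.sum_le_sum fun t ht => ?_
        have := hu t (Finset.mem_range.1 ht)
        gcongr
    _ = _ := by simp; ring
end
end
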